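/- Let H be a Hopf algebra over a commutative ring k, (δ, σ) a modular pair, and S̃(h) = δ(h₍₁₎) S(h₍₂₎). With τ₁(h) = S̃(h)·σ, one has for all h ∈ H: τ₁(τ₁(h)) = δ(h₍₁₎) · δ(S(h₍₃₎)) · S(σ) · S²(h₍₂₎) · σ. In particular, τ₁² is the conjugation by σ of S² pre- and post-composed with the δ-coadjoint projection. -/

import Mathlib

open TensorProduct Coalgebra HopfAlgebra

variable {k H : Type*} [CommRing k] [Ring H] [HopfAlgebra k H]

/-- The `δ`-twisted antipode `S̃(h) = δ(h₍₁₎) • S(h₍₂₎)`. -/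
noncomputable def twistedAntipode (δ : H →ₐ[k] k) : H →ₗ[k] H :=
  (TensorProduct.lid k H).toLinearMap ∘ₗ
    TensorProduct.map δ.toLinearMap (antipode (R := k)) ∘ₗ Coalgebra.comul

open MulOpposite WithConv

/-- The `δ`-twisted antipode as an algebra homomorphism into the opposite algebra. -/
noncomputable def twistedAntipodeAlgHomOp (δ : H →ₐ[k] k) : H →ₐ[k] Hᵐᵒᵖ :=
  (Algebra.TensorProduct.lift ((Algebra.ofId k Hᵐᵒᵖ).comp δ) (antipodeAlgHomOp k H)
    fun x _ => Algebra.commute_algebraMap_left (δ x) _).comp (Bialgebra.comulAlgHom k H)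

lemma twistedAntipode_eq_sum (δ : H →ₐ[k] k) {ι : Type*} {h : H} (r : Coalgebra.Repr k h ι) :
    twistedAntipode δ h = ∑ i ∈ r.index, δ (r.left i) • antipode k (r.right i) := by
  simp [twistedAntipode, ← r.eq]

lemma twistedAntipodeAlgHomOp_apply (δ : H →ₐ[k] k) (h : H) :
    twistedAntipodeAlgHomOp δ h = op (twistedAntipode δ h) := by
  rw [twistedAntipode_eq_sum δ (ℛ k h)]
  simp [twistedAntipodeAlgHomOp, antipodeAlgHomOp, ← (ℛ k h).eq, Algebra.ofId_apply,
    Algebra.smul_def]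
  exact Finset.sum_congr rfl fun _ _ => by rw [← op_mul, ← op_mul, Algebra.commutes]

lemma twistedAntipode_mul (δ : H →ₐ[k] k) (x y : H) :
    twistedAntipode δ (x * y) = twistedAntipode δ y * twistedAntipode δ x := by
  apply op_injective
  simp [← twistedAntipodeAlgHomOp_apply]

lemma algHom_comp_antipode_convMul {A : Type*} [Ring A] [Algebra k A] (f : H →ₐ[k] A) :
    toConv (f.toLinearMap ∘ₗ antipode k) * toConv f.toLinearMap = 1 := by
  have := LinearMap.algHom_comp_convMul_distrib f (toConv (antipode k (A := H)))
    (toConv LinearMap.id)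
  rw [LinearMap.antipode_mul_id] at this
  apply WithConv.ofConv_injective
  refine this.symm.trans ?_
  ext; simp

lemma algHom_convMul_comp_antipode {A : Type*} [Ring A] [Algebra k A] (f : H →ₐ[k] A) :
    toConv f.toLinearMap * toConv (f.toLinearMap ∘ₗ antipode k) = 1 := by
  have := LinearMap.algHom_comp_convMul_distrib f (toConv LinearMap.id)
    (toConv (antipode k (A := H)))
  rw [LinearMap.id_mul_antipode] at this
  apply WithConv.ofConv_injective
  refine this.symm.trans ?_
  ext; simp

lemma toConv_twistedAntipodeAlgHomOp (δ : H →ₐ[k] k) :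
    toConv (twistedAntipodeAlgHomOp δ).toLinearMap =
      toConv ((Algebra.ofId k Hᵐᵒᵖ).comp δ).toLinearMap *
        toConv (antipodeAlgHomOp k H).toLinearMap := by
  ext h
  rw [(ℛ k h).convMul_apply]
  simp [twistedAntipodeAlgHomOp, antipodeAlgHomOp, ← (ℛ k h).eq]

/-- Both sides are the convolution inverse of the twisted antipode in `Hom(H, Hᵐᵒᵖ)`. -/
lemma toConv_twistedAntipodeAlgHomOp_comp_antipode (δ : H →ₐ[k] k) :
    toConv ((twistedAntipodeAlgHomOp δ).toLinearMap ∘ₗ antipode k) =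
      toConv ((antipodeAlgHomOp k H).toLinearMap ∘ₗ antipode k) *
        toConv (((Algebra.ofId k Hᵐᵒᵖ).comp δ).toLinearMap ∘ₗ antipode k) := by
  refine left_inv_eq_right_inv (algHom_comp_antipode_convMul _) ?_
  rw [toConv_twistedAntipodeAlgHomOp, mul_assoc,
    ← mul_assoc (toConv (antipodeAlgHomOp k H).toLinearMap),
    algHom_convMul_comp_antipode, one_mul, algHom_convMul_comp_antipode]

lemma twistedAntipode_antipode (δ : H →ₐ[k] k) {ι : Type*} {h : H} (r : Coalgebra.Repr k h ι) :
    twistedAntipode δ (antipode k h) =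
      ∑ i ∈ r.index, δ (antipode k (r.right i)) • antipode k (antipode k (r.left i)) := by
  apply op_injective
  rw [← twistedAntipodeAlgHomOp_apply]
  have := congr($(toConv_twistedAntipodeAlgHomOp_comp_antipode δ) h)
  rw [r.convMul_apply] at this
  simpa [antipodeAlgHomOp, Algebra.ofId_apply, ← op_mul, ← op_smul, Algebra.smul_def] using this

lemma twistedAntipode_of_comul_eq (δ : H →ₐ[k] k) {σ : H}
    (hΔ : Coalgebra.comul (R := k) σ = σ ⊗ₜ[k] σ) :
    twistedAntipode δ σ = δ σ • antipode k σ := by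
  simp [twistedAntipode, hΔ]

/-- τ₁²(h) = δ(h₍₁₎) δ(S(h₍₃₎)) • (S(σ) · S²(h₍₂₎) · σ). -/
theorem tau1_sq_formula (δ : H →ₐ[k] k) (σ : H)
    (hΔ : Coalgebra.comul (R := k) σ = σ ⊗ₜ[k] σ)
    (hε : Coalgebra.counit (R := k) σ = (1 : k))
    (hδσ : δ σ = 1) (h : H) :
    twistedAntipode δ (twistedAntipode δ h * σ) * σ =
      ((TensorProduct.lid k H).toLinearMap ∘ₗ
        TensorProduct.map δ.toLinearMap
          ((TensorProduct.rid k H).toLinearMap ∘ₗ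
            TensorProduct.map
              (LinearMap.mulLeft k (antipode (R := k) σ) ∘ₗ
                LinearMap.mulRight k σ ∘ₗ antipode (R := k) ∘ₗ antipode (R := k))
              (δ.toLinearMap ∘ₗ antipode (R := k))) ∘ₗ
        LinearMap.lTensor H Coalgebra.comul ∘ₗ Coalgebra.comul) h := by
  rw [twistedAntipode_mul, twistedAntipode_of_comul_eq δ hΔ, hδσ, one_smul,
    twistedAntipode_eq_sum δ (ℛ k h)]
  simp only [LinearMap.comp_apply]
  conv_rhs => rw [← (ℛ k h).eq]
  simp only [map_sum, map_smul, Finset.mul_sum, Finset.sum_mul]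
  refine Finset.sum_congr rfl fun i _ => ?_
  rw [twistedAntipode_antipode δ (ℛ k ((ℛ k h).right i)), LinearMap.lTensor_tmul]
  conv_rhs => rw [← (ℛ k ((ℛ k h).right i)).eq]
  simp [Finset.mul_sum, Finset.sum_mul, mul_assoc]
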